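/- Let H be an elementary abelian 2-hypergroup built from p involutions, p♯ of which are thick. Then the number of all closed subsets of H equals 2^{p♯} · Σ_{r=0}^{p−p♯} C(p−p♯, r)_2, and the number of all strongly normal closed subsets of H equals Σ_{r=0}^{p−p♯} C(p−p♯, r)_2, where C(n, r)_2 denotes the Gaussian binomial coefficient with base 2. -/

import Mathlib

namespace HyperPaper

/-- A hypergroup: hypermultiplication `hmul`, inversion `star`, identity `e`,
satisfying (H1) associativity, (H2) unique two-sided identity, (H3) exchange conditions. -/
structure Hypergroup (H : Type*) where
  hmul : H → H → Set H
  star : H → H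
  e : H
  idl : ∀ p, hmul e p = {p}
  idr : ∀ p, hmul p e = {p}
  e_unique : ∀ e' : H, (∀ p, hmul e' p = {p} ∧ hmul p e' = {p}) → e' = e
  assoc : ∀ p q r : H, (⋃ x ∈ hmul p q, hmul x r) = ⋃ x ∈ hmul q r, hmul p x
  h3l : ∀ p q r : H, p ∈ hmul q r ↔ q ∈ hmul p (star r)
  h3r : ∀ p q r : H, p ∈ hmul q r ↔ r ∈ hmul (star q) p

variable {H : Type*}

namespace Hypergroup

/-- Product of two subsets: FG = {a : ∃ b ∈ F, c ∈ G, a ∈ bc}. -/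
def smul (hg : Hypergroup H) (F G : Set H) : Set H :=
  {a | ∃ b ∈ F, ∃ c ∈ G, a ∈ hg.hmul b c}

/-- Closed subset: nonempty and G*G ⊆ G. -/
def IsClosed (hg : Hypergroup H) (G : Set H) : Prop :=
  G.Nonempty ∧ hg.smul (hg.star '' G) G ⊆ G

/-- Thin element: p*p = {e}. -/
def IsThin (hg : Hypergroup H) (p : H) : Prop := hg.hmul (hg.star p) p = {hg.e}

/-- Thick element: not thin. -/
def IsThick (hg : Hypergroup H) (p : H) : Prop := ¬ hg.IsThin p

/-- Involution: p ≠ e and {e, p} is closed. -/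
def IsInvolution (hg : Hypergroup H) (p : H) : Prop :=
  p ≠ hg.e ∧ hg.IsClosed {hg.e, p}

/-- ⟨G⟩: smallest closed subset containing G. -/
def gen (hg : Hypergroup H) (G : Set H) : Set H := ⋂₀ {C | hg.IsClosed C ∧ G ⊆ C}

/-- O_ϑ(G): the thin elements of H lying in G. -/
def Othin (hg : Hypergroup H) (G : Set H) : Set H := {p ∈ G | hg.IsThin p}

/-- F is a strongly normal closed subset of G: p*Fp ⊆ F ⊆ G for all p ∈ G. -/
def IsStronglyNormal (hg : Hypergroup H) (F G : Set H) : Prop :=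
  hg.IsClosed F ∧ hg.IsClosed G ∧ F ⊆ G ∧
    ∀ p ∈ G, hg.smul (hg.smul {hg.star p} F) {p} ⊆ F

/-- O^ϑ(G): intersection of all strongly normal closed subsets of ⟨G⟩. -/
def Osup (hg : Hypergroup H) (G : Set H) : Set H :=
  ⋂₀ {F | hg.IsStronglyNormal F (hg.gen G)}

/-- F is a normal closed subset of G. -/
def IsNormal (hg : Hypergroup H) (F G : Set H) : Prop :=
  hg.IsClosed F ∧ hg.IsClosed G ∧ F ⊆ G ∧ ∀ p ∈ G, hg.smul F {p} = hg.smul {p} F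

/-- Product of a list of subsets (empty product is {e}). -/
def listProd (hg : Hypergroup H) : List (Set H) → Set H
  | [] => {hg.e}
  | a :: l => hg.smul a (hg.listProd l)

/-- Product r_1 r_2 ⋯ r_n of a family of elements. -/
def famProd (hg : Hypergroup H) {n : ℕ} (r : Fin n → H) : Set H :=
  hg.listProd ((List.finRange n).map fun i => ({r i} : Set H))

/-- Ĝ_i: the product of the G_j with j ≠ i. -/
def cofactor (hg : Hypergroup H) {n : ℕ} (G : Fin n → Set H) (i : Fin n) : Set H :=
  hg.listProd (((List.finRange n).filter fun j => decide (j ≠ i)).map G)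

/-- H is the direct product of the normal closed subsets G_1, …, G_n. -/
def IsDirectProduct (hg : Hypergroup H) {n : ℕ} (G : Fin n → Set H) : Prop :=
  (∀ i, hg.IsNormal (G i) Set.univ) ∧
  (∀ i, hg.smul (G i) (hg.cofactor G i) = Set.univ) ∧
  (∀ i, G i ∩ hg.cofactor G i = {hg.e})

/-- r : Fin n → H is a decomposition of x with respect to the family G. -/
def IsDecomp (hg : Hypergroup H) {n : ℕ} (G : Fin n → Set H) (x : H) (r : Fin n → H) : Prop :=
  (∀ i, r i ∈ G i) ∧ x ∈ hg.famProd r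

/-- The support of x: the elements ≠ e appearing in the decomposition of x. -/
def dsupport (hg : Hypergroup H) {n : ℕ} (G : Fin n → Set H) (x : H) : Set H :=
  {y | y ≠ hg.e ∧ ∃ r, hg.IsDecomp G x r ∧ y ∈ Set.range r}

/-- The cover of x: the product r_1r_2⋯r_n for the decomposition of x. -/
def dcover (hg : Hypergroup H) {n : ℕ} (G : Fin n → Set H) (x : H) : Set H :=
  {y | ∃ r, hg.IsDecomp G x r ∧ y ∈ hg.famProd r}

/-- x is constrained: its cover equals {x}. -/
def IsConstrained (hg : Hypergroup H) {n : ℕ} (G : Fin n → Set H) (x : H) : Prop :=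
  hg.dcover G x = {x}

/-- r_2(G): the largest 2-rank of a thin closed subset of H contained in G
(equivalently, the largest k such that G contains a thin symmetric closed subset
of 2^k elements, which corresponds to an elementary abelian 2-group of 2-rank k). -/
noncomputable def rank2 (hg : Hypergroup H) (G : Set H) : ℕ :=
  sSup {k | ∃ U : Set H, hg.IsClosed U ∧ U ⊆ G ∧ (∀ u ∈ U, hg.IsThin u) ∧
    (∀ u ∈ U, hg.star u = u) ∧ U.ncard = 2 ^ k}

/-- F is a minimal generating subset of G. -/
def IsMinGen (hg : Hypergroup H) (G F : Set H) : Prop :=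
  F ⊆ G ∧ hg.gen F = G ∧ ∀ p ∈ F, hg.gen (F \ {p}) ≠ G

/-- The dimension of G: the smallest cardinality of a minimal generating subset. -/
noncomputable def dimension (hg : Hypergroup H) (G : Set H) : ℕ :=
  sInf {k | ∃ F : Set H, hg.IsMinGen G F ∧ F.Finite ∧ F.ncard = k}

/-- [F, G] = ⟨{a : ∃ b ∈ F, c ∈ G, a ∈ b*c*bc}⟩. -/
def commSet (hg : Hypergroup H) (F G : Set H) : Set H :=
  hg.gen {a | ∃ b ∈ F, ∃ c ∈ G,
    a ∈ hg.smul (hg.smul (hg.smul {hg.star b} {hg.star c}) {b}) {c}}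

/-- derived G k = G^{(k+1)}: G^{(1)} = G, G^{(r)} = [G^{(r-1)}, G]. -/
def derived (hg : Hypergroup H) (G : Set H) : ℕ → Set H
  | 0 => G
  | k + 1 => hg.commSet (hg.derived G k) G

/-- G is nilpotent: G^{(r)} = {e} for some r. -/
def IsNilpotent (hg : Hypergroup H) (G : Set H) : Prop :=
  ∃ k : ℕ, hg.derived G k = {hg.e}

/-- G is a residually thin closed subset: there is a chain {e} = F_1, …, F_n = G of
pairwise distinct closed subsets, each strongly normal in the next. -/
def IsResiduallyThin (hg : Hypergroup H) (G : Set H) : Prop :=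
  ∃ (m : ℕ) (F : Fin (m + 1) → Set H), Function.Injective F ∧
    F 0 = {hg.e} ∧ F (Fin.last m) = G ∧
    ∀ i : Fin m, hg.IsStronglyNormal (F i.castSucc) (F i.succ)

/-- x^k as a subset: x^0 = {e}, x^{k+1} = x^k · x. -/
def spow (hg : Hypergroup H) (x : H) : ℕ → Set H
  | 0 => {hg.e}
  | k + 1 => hg.smul (hg.spow x k) {x}

/-- F is a maximal closed subset of G. -/
def IsMaximalClosed (hg : Hypergroup H) (F G : Set H) : Prop :=
  hg.IsClosed F ∧ hg.IsClosed G ∧ F ⊆ G ∧ F ≠ G ∧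
    ∀ E : Set H, hg.IsClosed E → F ⊆ E → E ⊆ G → E = F ∨ E = G

/-- The Frattini closed subset of G: the intersection (inside G) of all maximal
closed subsets of G. -/
def frattini (hg : Hypergroup H) (G : Set H) : Set H :=
  G ∩ ⋂₀ {F | hg.IsMaximalClosed F G}

/-- α is an isomorphism from the closed subset F to the closed subset G. -/
def IsIso (hg : Hypergroup H) (F G : Set H) (α : H → H) : Prop :=
  Set.BijOn α F G ∧ α hg.e = hg.e ∧
    ∀ p ∈ F, ∀ q ∈ F, α '' hg.hmul p q = hg.hmul (α p) (α q)

/-- F ≃ G: there is an isomorphism from F to G. -/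
def Isomorphic (hg : Hypergroup H) (F G : Set H) : Prop := ∃ α : H → H, hg.IsIso F G α

/-- Aut(G): the automorphism group of G, realized as the subgroup of permutations of G
that fix e and preserve the hypermultiplication. -/
def autGroup (hg : Hypergroup H) (G : Set H) : Subgroup (Equiv.Perm G) where
  carrier := {σ | (∀ x : G, (x : H) = hg.e → ((σ x : H)) = hg.e) ∧
    ∀ p q x : G, (x : H) ∈ hg.hmul p q ↔ ((σ x : H)) ∈ hg.hmul (σ p) (σ q)}
  one_mem' := by
    constructor
    · intro x hx; simpa using hx
    · intro p q x; simp
  mul_mem' := by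
    rintro σ τ ⟨he1, hm1⟩ ⟨he2, hm2⟩
    refine ⟨fun x hx => ?_, fun p q x => ?_⟩
    · simpa using he1 _ (he2 x hx)
    · simpa using (hm2 p q x).trans (hm1 (τ p) (τ q) (τ x))
  inv_mem' := by
    rintro σ ⟨he, hm⟩
    refine ⟨fun x hx => ?_, fun p q x => ?_⟩
    · have h2 : σ x = x := Subtype.ext ((he x hx).trans hx.symm)
      have h3 : σ⁻¹ x = x := by
        conv_lhs => rw [← h2]
        simp
      rw [h3]; exact hx
    · have h := hm (σ⁻¹ p) (σ⁻¹ q) (σ⁻¹ x)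
      simpa using h.symm

end Hypergroup

/-- An elementary abelian 2-hypergroup: a hypergroup that is the constrained direct
product of the closed subsets ⟨q_1⟩, …, ⟨q_n⟩ generated by involutions q_1, …, q_n. -/
structure EA2Data (H : Type*) where
  hg : Hypergroup H
  n : ℕ
  q : Fin n → H
  invol : ∀ i, hg.IsInvolution (q i)
  dp : hg.IsDirectProduct fun i => hg.gen {q i}
  constrained : ∀ x : H, hg.IsConstrained (fun i => hg.gen {q i}) x

namespace EA2Data

/-- The family ⟨q_1⟩, …, ⟨q_n⟩. -/
def fam (E : EA2Data H) : Fin E.n → Set H := fun i => E.hg.gen {E.q i}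

/-- The support of x. -/
def support (E : EA2Data H) (x : H) : Set H := E.hg.dsupport E.fam x

/-- Thick(F): externally thick elements of H lying in F. -/
def ThickIn (E : EA2Data H) (F : Set H) : Set H :=
  {x ∈ F | x = E.hg.e ∨ ∀ y ∈ E.support x, E.hg.IsThick y}

/-- Thin(F): externally thin elements of H lying in F. -/
def ThinIn (E : EA2Data H) (F : Set H) : Set H :=
  {x ∈ F | x = E.hg.e ∨ ∀ y ∈ E.support x, E.hg.IsThin y}

/-- The (unique) pair (x⁺, x⁻) with x⁺ ∈ Thick(H), x⁻ ∈ Thin(H), x⁺x⁻ = {x}. -/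
noncomputable def pm (E : EA2Data H) (x : H) : H × H :=
  @Classical.epsilon (H × H) ⟨(E.hg.e, E.hg.e)⟩ fun z =>
    z.1 ∈ E.ThickIn Set.univ ∧ z.2 ∈ E.ThinIn Set.univ ∧ E.hg.hmul z.1 z.2 = {x}

/-- x⁺. -/
noncomputable def plus (E : EA2Data H) (x : H) : H := (E.pm x).1

/-- x⁻. -/
noncomputable def minus (E : EA2Data H) (x : H) : H := (E.pm x).2

/-- s(x): the number of thick elements of H in the support of x. -/
noncomputable def sElem (E : EA2Data H) (x : H) : ℕ :=
  {y ∈ E.support x | E.hg.IsThick y}.ncard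

/-- s(G) = max {s(a) : a ∈ G}. -/
noncomputable def sSet (E : EA2Data H) (G : Set H) : ℕ :=
  sSup {k | ∃ a ∈ G, E.sElem a = k}

/-- x ⪯ y: the support of x is contained in the support of y. -/
def ple (E : EA2Data H) (x y : H) : Prop := E.support x ⊆ E.support y

/-- p♯: the number of thick elements among q_1, …, q_n. -/
noncomputable def psharp (E : EA2Data H) : ℕ := {i : Fin E.n | E.hg.IsThick (E.q i)}.ncard

end EA2Data

/-- The Gaussian binomial coefficient C(n, k)_2 with base 2, via the
q-Pascal recurrence C(n, k)_2 = C(n-1, k-1)_2 + 2^k · C(n-1, k)_2. -/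
def gaussBinom2 : ℕ → ℕ → ℕ
  | _, 0 => 1
  | 0, _ + 1 => 0
  | n + 1, k + 1 => gaussBinom2 n k + 2 ^ (k + 1) * gaussBinom2 n (k + 1)

end HyperPaper

open HyperPaper

namespace HyperPaper

section Subspaces

open Module

/-- The subspaces of `V` of dimension `r`. -/
def subspacesOfRank (K V : Type*) [Field K] [AddCommGroup V] [Module K V] (r : ℕ) :
    Set (Submodule K V) := {W | finrank K W = r}

variable {K V V' : Type*} [Field K] [AddCommGroup V] [Module K V] [AddCommGroup V'] [Module K V']

theorem ncard_subspacesOfRank_congr (f : V ≃ₗ[K] V') (r : ℕ) :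
    (subspacesOfRank K V r).ncard = (subspacesOfRank K V' r).ncard := by
  have hinj : Function.Injective (Submodule.map (f : V →ₗ[K] V')) :=
    Submodule.map_injective_of_injective f.injective
  rw [← Set.ncard_image_of_injective _ hinj]
  congr 1
  ext W
  constructor
  · rintro ⟨U, hU, rfl⟩
    exact (LinearEquiv.finrank_map_eq f U).trans hU
  · intro hW
    refine ⟨W.map (f.symm : V' →ₗ[K] V), (LinearEquiv.finrank_map_eq f.symm W).trans hW, ?_⟩
    ext x
    simp

theorem finrank_linearPMap_graph (f : V →ₗ.[K] K) : finrank K f.graph = finrank K f.domain := by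
  have hinj : Function.Injective (f.domain.subtype.prodMap (LinearMap.id : K →ₗ[K] K)) := by
    rintro ⟨a, b⟩ ⟨c, d⟩ h
    simpa [Prod.ext_iff] using h
  rw [LinearPMap.graph, ← (Submodule.equivMapOfInjective _ hinj _).finrank_eq,
    LinearMap.graph_eq_range_prod]
  exact LinearMap.finrank_range_of_inj fun a b h => congrArg Prod.fst h

theorem finrank_prod_top [FiniteDimensional K V] (U : Submodule K V) :
    finrank K (U.prod (⊤ : Submodule K K)) = finrank K U + 1 := by
  have hinj : Function.Injective (U.subtype.prodMap (LinearMap.id : K →ₗ[K] K)) := by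
    rintro ⟨a, b⟩ ⟨c, d⟩ h
    simpa [Prod.ext_iff] using h
  have h := LinearMap.finrank_range_of_inj hinj
  rwa [LinearMap.range_prodMap, Submodule.range_subtype, LinearMap.range_id, finrank_prod,
    finrank_self] at h

theorem ncard_linearPMap [Finite K] [Finite V] (r : ℕ) :
    {f : V →ₗ.[K] K | finrank K f.domain = r}.ncard =
      Nat.card K ^ r * (subspacesOfRank K V r).ncard := by
  have : Finite (Submodule K V) := Finite.of_injective _ SetLike.coe_injective
  let e : {f : V →ₗ.[K] K | finrank K f.domain = r} ≃
      Σ W : subspacesOfRank K V r, (W.1 →ₗ[K] K) :=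
    { toFun := fun f => ⟨⟨f.1.domain, f.2⟩, f.1.toFun⟩
      invFun := fun g => ⟨⟨g.1.1, g.2⟩, g.1.2⟩
      left_inv := fun _ => rfl
      right_inv := fun _ => rfl }
  have := Fintype.ofFinite (subspacesOfRank K V r)
  have hfin (W : Submodule K V) : Finite (W →ₗ[K] K) :=
    Finite.of_injective _ DFunLike.coe_injective
  rw [← Nat.card_coe_set_eq, Nat.card_congr e, Nat.card_sigma]
  have hdual (W : subspacesOfRank K V r) : Nat.card (W.1 →ₗ[K] K) = Nat.card K ^ r := by
    rw [Module.natCard_eq_pow_finrank (K := K)]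
    congr 1
    exact Subspace.dual_finrank_eq.trans W.2
  simp only [hdual, Finset.sum_const, Finset.card_univ, smul_eq_mul]
  rw [← Nat.card_eq_fintype_card, Nat.card_coe_set_eq, mul_comm]

theorem ncard_subspacesOfRank_prod [Finite K] [Finite V] (r : ℕ) :
    (subspacesOfRank K (V × K) (r + 1)).ncard = (subspacesOfRank K V r).ncard +
      Nat.card K ^ (r + 1) * (subspacesOfRank K V (r + 1)).ncard := by
  have : Finite (Submodule K V) := Finite.of_injective _ SetLike.coe_injective
  have : Finite (Submodule K (V × K)) := Finite.of_injective _ SetLike.coe_injective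
  have hprod : Function.Injective fun W : Submodule K V => W.prod (⊤ : Submodule K K) := by
    intro W W' h
    ext x
    simpa using SetLike.ext_iff.1 h (x, 0)
  have hgraph : Function.Injective (LinearPMap.graph : (V →ₗ.[K] K) → _) :=
    fun _ _ => LinearPMap.eq_of_eq_graph
  rw [← ncard_linearPMap, ← Set.ncard_image_of_injective _ hprod,
    ← Set.ncard_image_of_injective _ hgraph, ← Set.ncard_union_eq]
  · congr 1
    ext W
    constructor
    · intro hW
      by_cases h : ((0, 1) : V × K) ∈ W
      · left
        have hsmul (y : K) : ((0, y) : V × K) ∈ W := by simpa using W.smul_mem y h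
        have hWprod : (W.map (LinearMap.fst K V K)).prod ⊤ = W := by
          ext ⟨x, y⟩
          simp only [Submodule.mem_prod, Submodule.mem_map, LinearMap.fst_apply, Prod.exists,
            exists_and_right, exists_eq_right, Submodule.mem_top, and_true]
          constructor
          · rintro ⟨z, hz⟩
            simpa using W.add_mem hz (hsmul (y - z))
          · exact fun hxy => ⟨y, hxy⟩
        refine ⟨W.map (LinearMap.fst K V K), ?_, hWprod⟩
        have hW' : finrank K W = r + 1 := hW
        rw [← hWprod, finrank_prod_top] at hW'
        exact Nat.succ_injective hW'
      · right
        have hfun : ∀ x ∈ W, x.1 = 0 → x.2 = 0 := by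
          rintro ⟨x, y⟩ hxy rfl
          by_contra hy
          exact h (by simpa [hy] using W.smul_mem y⁻¹ hxy)
        refine ⟨W.toLinearPMap, ?_, W.toLinearPMap_graph_eq hfun⟩
        rw [Set.mem_ofPred_eq, ← finrank_linearPMap_graph, W.toLinearPMap_graph_eq hfun]
        exact hW
    · rintro (⟨U, hU, rfl⟩ | ⟨f, hf, rfl⟩)
      · exact (finrank_prod_top U).trans (congrArg (· + 1) hU)
      · exact (finrank_linearPMap_graph f).trans hf
  · rw [Set.disjoint_left]
    rintro _ ⟨U, hU, rfl⟩ ⟨f, hf, hfU⟩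
    have h : ((0, 1) : V × K) ∈ f.graph := by simp [hfU]
    exact one_ne_zero (LinearPMap.graph_fst_eq_zero_snd f h rfl)

theorem ncard_subspacesOfRank_zero [FiniteDimensional K V] :
    (subspacesOfRank K V 0).ncard = 1 := by
  rw [Set.ncard_eq_one]
  refine ⟨⊥, ?_⟩
  ext W
  exact Submodule.finrank_eq_zero

theorem ncard_subspacesOfRank_eq_gaussBinom2 (n r : ℕ) [Module (ZMod 2) V] [Finite V]
    (hV : finrank (ZMod 2) V = n) : (subspacesOfRank (ZMod 2) V r).ncard = gaussBinom2 n r := by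
  have key : (subspacesOfRank (ZMod 2) (Fin n → ZMod 2) r).ncard = gaussBinom2 n r := by
    clear hV
    induction n generalizing r with
    | zero =>
      cases r with
      | zero => rw [ncard_subspacesOfRank_zero, gaussBinom2]
      | succ r =>
        rw [gaussBinom2, Set.ncard_eq_zero (Set.toFinite _), Set.eq_empty_iff_forall_notMem]
        intro W hW
        have hW' : finrank (ZMod 2) W = r + 1 := hW
        have := W.finrank_le
        simp [hW'] at this
    | succ n ih =>
      cases r with
      | zero => rw [ncard_subspacesOfRank_zero, gaussBinom2]
      | succ r =>
        have e : (Fin (n + 1) → ZMod 2) ≃ₗ[ZMod 2] (Fin n → ZMod 2) × ZMod 2 :=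
          LinearEquiv.ofFinrankEq _ _ (by simp)
        rw [ncard_subspacesOfRank_congr e, ncard_subspacesOfRank_prod, ih, ih, gaussBinom2,
          Nat.card_zmod]
  rw [← key]
  exact ncard_subspacesOfRank_congr (LinearEquiv.ofFinrankEq _ _ (by simp [hV])) r

theorem card_submodule_eq_sum_gaussBinom2 (n : ℕ) [Module (ZMod 2) V] [Finite V]
    (hV : finrank (ZMod 2) V = n) :
    Nat.card (Submodule (ZMod 2) V) = ∑ r ∈ Finset.range (n + 1), gaussBinom2 n r := by
  have : Finite (Submodule (ZMod 2) V) := Finite.of_injective _ SetLike.coe_injective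
  have := Fintype.ofFinite (Submodule (ZMod 2) V)
  classical
  rw [Nat.card_eq_fintype_card, ← Finset.card_univ,
    Finset.card_eq_sum_card_fiberwise (f := fun W : Submodule (ZMod 2) V => finrank (ZMod 2) W)
      (t := Finset.range (n + 1))]
  · refine Finset.sum_congr rfl fun r _ => ?_
    rw [← ncard_subspacesOfRank_eq_gaussBinom2 n r hV, Set.ncard_eq_toFinset_card']
    congr 1
    ext W
    simp only [Finset.mem_filter_univ, Set.mem_toFinset]
    rfl
  · intro W _
    simpa [Nat.lt_succ_iff, ← hV] using W.finrank_le

end Subspaces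

section Families

variable {ι : Type*} {K : Set ι}

theorem zmod_two_eq_zero_or_one (a : ZMod 2) : a = 0 ∨ a = 1 := by
  revert a
  decide

/-- `u` occurs in the product of `s` and `t`, when elements are encoded by their coordinates and
`K` is the set of thick coordinates. -/
def OccursIn (K : Set ι) (s t u : ι → ZMod 2) : Prop :=
  ∀ i, u i = s i + t i ∨ (i ∈ K ∧ s i = 1 ∧ t i = 1)

/-- The coordinate form of a closed subset. -/
def IsClosedFamily (K : Set ι) (C : Set (ι → ZMod 2)) : Prop :=
  C.Nonempty ∧ ∀ s ∈ C, ∀ t ∈ C, ∀ u, OccursIn K s t u → u ∈ C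

/-- The coordinate form of a strongly normal closed subset. -/
def IsStronglyNormalFamily (K : Set ι) (C : Set (ι → ZMod 2)) : Prop :=
  IsClosedFamily K C ∧ ∀ p, ∀ s ∈ C, ∀ v, OccursIn K p s v → ∀ u, OccursIn K v p u → u ∈ C

/-- The functions that are supported on `M` within `K` and restrict to an element of `W`
outside `K`. -/
def familyOfPair (P : Set K × Submodule (ZMod 2) ((Kᶜ : Set ι) → ZMod 2)) : Set (ι → ZMod 2) :=
  {s | (∀ i : K, i ∉ P.1 → s i = 0) ∧ (fun i : (Kᶜ : Set ι) => s i) ∈ P.2}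

open Classical in
/-- Extension by zero of a function on the complement of `K`. -/
noncomputable def extendZero (w : (Kᶜ : Set ι) → ZMod 2) : ι → ZMod 2 :=
  fun i => if h : i ∈ K then 0 else w ⟨i, h⟩

theorem extendZero_of_mem (w : (Kᶜ : Set ι) → ZMod 2) {i : ι} (h : i ∈ K) :
    extendZero w i = 0 := dif_pos h

theorem extendZero_of_notMem (w : (Kᶜ : Set ι) → ZMod 2) {i : ι} (h : i ∉ K) :
    extendZero w i = w ⟨i, h⟩ := dif_neg h

theorem extendZero_mem_familyOfPair {P : Set K × Submodule (ZMod 2) ((Kᶜ : Set ι) → ZMod 2)}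
    {w : (Kᶜ : Set ι) → ZMod 2} : extendZero w ∈ familyOfPair P ↔ w ∈ P.2 := by
  have hw : (fun i : (Kᶜ : Set ι) => extendZero w i) = w :=
    funext fun i => extendZero_of_notMem w i.2
  change (_ ∧ (fun i : (Kᶜ : Set ι) => extendZero w i) ∈ P.2) ↔ _
  rw [hw]
  exact and_iff_right fun i _ => extendZero_of_mem w i.2

theorem single_mem_familyOfPair [DecidableEq ι]
    {P : Set K × Submodule (ZMod 2) ((Kᶜ : Set ι) → ZMod 2)} {i : K} :
    Pi.single (i : ι) 1 ∈ familyOfPair P ↔ i ∈ P.1 := by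
  have hw : (fun j : (Kᶜ : Set ι) => (Pi.single (i : ι) 1 : ι → ZMod 2) j) = 0 :=
    funext fun j => Pi.single_eq_of_ne (fun h : (j : ι) = i => j.2 (h ▸ i.2)) _
  change (_ ∧ (fun j : (Kᶜ : Set ι) => (Pi.single (i : ι) 1 : ι → ZMod 2) j) ∈ P.2) ↔ _
  rw [hw, and_iff_left P.2.zero_mem]
  constructor
  · intro h
    by_contra hi
    simpa using h i hi
  · intro hi j hj
    exact Pi.single_eq_of_ne (fun h => hj (by rwa [Subtype.ext h])) _

theorem familyOfPair_injective : Function.Injective (familyOfPair (K := K)) := by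
  classical
  intro P Q h
  refine Prod.ext (Set.ext fun i => ?_) (SetLike.ext fun w => ?_)
  · rw [← single_mem_familyOfPair, h, single_mem_familyOfPair]
  · rw [← extendZero_mem_familyOfPair, h, extendZero_mem_familyOfPair]

theorem isClosedFamily_familyOfPair
    (P : Set K × Submodule (ZMod 2) ((Kᶜ : Set ι) → ZMod 2)) :
    IsClosedFamily K (familyOfPair P) := by
  refine ⟨⟨extendZero 0, extendZero_mem_familyOfPair.2 P.2.zero_mem⟩, ?_⟩
  rintro s ⟨hs, hs'⟩ t ⟨ht, ht'⟩ u hu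
  constructor
  · intro i hi
    rcases hu i with h | ⟨_, h, _⟩
    · rw [h, hs i hi, ht i hi, add_zero]
    · simp [hs i hi] at h
  · convert P.2.add_mem hs' ht' using 1
    funext i
    exact (hu i).resolve_right fun h => i.2 h.1

theorem IsClosedFamily.extendZero_restrict_mem {C : Set (ι → ZMod 2)} (hC : IsClosedFamily K C)
    {s : ι → ZMod 2} (hs : s ∈ C) : extendZero (fun i : (Kᶜ : Set ι) => s i) ∈ C := by
  classical
  have hK : (fun i => if i ∈ K then s i else 0) ∈ C := by
    refine hC.2 s hs s hs _ fun i => ?_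
    by_cases hi : i ∈ K <;> rcases zmod_two_eq_zero_or_one (s i) with h | h <;>
      simp [hi, h, CharTwo.add_self_eq_zero]
  refine hC.2 s hs _ hK _ fun i => Or.inl ?_
  by_cases hi : i ∈ K
  · simp [extendZero_of_mem, hi, CharTwo.add_self_eq_zero]
  · simp [extendZero_of_notMem, hi]

theorem IsClosedFamily.exists_eq_familyOfPair [Finite ι] {C : Set (ι → ZMod 2)}
    (hC : IsClosedFamily K C) : ∃ P, familyOfPair (K := K) P = C := by
  classical
  have := Fintype.ofFinite ι
  have hadd {s t : ι → ZMod 2} (hs : s ∈ C) (ht : t ∈ C) : s + t ∈ C :=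
    hC.2 s hs t ht _ fun _ => Or.inl rfl
  let W : AddSubgroup ((Kᶜ : Set ι) → ZMod 2) :=
    { carrier := {w | extendZero w ∈ C}
      zero_mem' := by
        obtain ⟨s, hs⟩ := hC.1
        have h : extendZero (0 : (Kᶜ : Set ι) → ZMod 2) = s + s := by
          funext i
          by_cases hi : i ∈ K <;> simp [extendZero, hi, CharTwo.add_self_eq_zero]
        change extendZero (0 : (Kᶜ : Set ι) → ZMod 2) ∈ C
        exact h ▸ hadd hs hs
      add_mem' := by
        intro v w hv hw
        have h : extendZero (v + w) = extendZero v + extendZero w := by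
          funext i
          by_cases hi : i ∈ K <;> simp [extendZero, hi]
        change extendZero (v + w) ∈ C
        exact h ▸ hadd hv hw
      neg_mem' := by
        intro w hw
        rwa [show -w = w from funext fun i => CharTwo.neg_eq (w i)] }
  refine ⟨({i | Pi.single (i : ι) 1 ∈ C}, AddSubgroup.toZModSubmodule 2 W), ?_⟩
  ext s
  constructor
  · rintro ⟨hs, hs'⟩
    have hind (A : Finset ι) : (fun i => if i ∈ K ∧ i ∉ A then 0 else s i) ∈ C := by
      induction A using Finset.induction_on with
      | empty =>
        convert (show extendZero (fun i : (Kᶜ : Set ι) => s i) ∈ C from hs') using 1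
        funext i
        by_cases hi : i ∈ K <;> simp [extendZero, hi]
      | insert a A ha ih =>
        by_cases hsa : a ∈ K ∧ s a = 1
        · have hsingle : Pi.single a 1 ∈ C := by
            by_contra h
            simpa [hsa.2] using hs ⟨a, hsa.1⟩ h
          refine hC.2 _ ih _ hsingle _ fun i => Or.inl ?_
          by_cases hi : i = a
          · subst hi
            simp [hsa, ha]
          · simp [hi]
        · convert ih using 1
          funext i
          by_cases hi : i = a
          · subst hi
            by_cases hiK : i ∈ K
            · simp [(zmod_two_eq_zero_or_one (s i)).resolve_right fun h => hsa ⟨hiK, h⟩]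
            · simp [hiK]
          · simp [hi]
    simpa using hind Finset.univ
  · intro hs
    refine ⟨fun i hi => ?_, hC.extendZero_restrict_mem hs⟩
    by_contra hsi
    have hsi' := (zmod_two_eq_zero_or_one (s i)).resolve_left hsi
    refine hi (hC.2 s hs s hs _ fun j => ?_)
    by_cases hj : j = i
    · subst hj
      exact Or.inr ⟨i.2, hsi', hsi'⟩
    · simp [hj, CharTwo.add_self_eq_zero]

theorem setOf_isClosedFamily [Finite ι] :
    {C | IsClosedFamily K C} = Set.range (familyOfPair (K := K)) :=
  Set.ext fun _ => ⟨fun hC => hC.exists_eq_familyOfPair,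
    fun ⟨P, hP⟩ => hP ▸ isClosedFamily_familyOfPair P⟩

theorem isStronglyNormalFamily_familyOfPair
    {P : Set K × Submodule (ZMod 2) ((Kᶜ : Set ι) → ZMod 2)} :
    IsStronglyNormalFamily K (familyOfPair P) ↔ P.1 = Set.univ := by
  classical
  constructor
  · rintro ⟨-, h⟩
    refine Set.eq_univ_of_forall fun i => ?_
    rw [← single_mem_familyOfPair]
    refine h (Pi.single (i : ι) 1) (extendZero 0)
      (extendZero_mem_familyOfPair.2 P.2.zero_mem) (Pi.single (i : ι) 1) (fun j => Or.inl ?_) _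
      fun j => ?_
    · by_cases hj : j ∈ K <;> simp [extendZero, hj]
    · by_cases hj : j = i
      · subst hj
        simp
      · simp [hj]
  · intro hP
    refine ⟨isClosedFamily_familyOfPair P, ?_⟩
    rintro p s ⟨-, hs⟩ v hv u hu
    refine ⟨fun i hi => (hi (hP ▸ Set.mem_univ i)).elim, ?_⟩
    convert hs using 1
    funext i
    rw [(hu i).resolve_right fun h => i.2 h.1, (hv i).resolve_right fun h => i.2 h.1,
      add_right_comm, CharTwo.add_self_eq_zero, zero_add]

theorem setOf_isStronglyNormalFamily [Finite ι] :
    {C | IsStronglyNormalFamily K C} =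
      Set.range fun W => familyOfPair (K := K) (Set.univ, W) := by
  ext C
  constructor
  · intro hC
    obtain ⟨⟨M, W⟩, rfl⟩ := hC.1.exists_eq_familyOfPair
    obtain rfl : M = Set.univ := isStronglyNormalFamily_familyOfPair.1 hC
    exact ⟨W, rfl⟩
  · rintro ⟨W, rfl⟩
    exact isStronglyNormalFamily_familyOfPair.2 rfl

theorem ncard_isClosedFamily [Finite ι] : {C | IsClosedFamily K C}.ncard =
    2 ^ K.ncard * Nat.card (Submodule (ZMod 2) ((Kᶜ : Set ι) → ZMod 2)) := by
  have := Fintype.ofFinite K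
  rw [setOf_isClosedFamily, ← Set.image_univ,
    Set.ncard_image_of_injective _ familyOfPair_injective, Set.ncard_univ, Nat.card_prod,
    Nat.card_eq_fintype_card, Fintype.card_set, ← Nat.card_eq_fintype_card, Nat.card_coe_set_eq]

theorem ncard_isStronglyNormalFamily [Finite ι] : {C | IsStronglyNormalFamily K C}.ncard =
    Nat.card (Submodule (ZMod 2) ((Kᶜ : Set ι) → ZMod 2)) := by
  rw [setOf_isStronglyNormalFamily, ← Set.image_univ, Set.ncard_image_of_injective,
    Set.ncard_univ]
  exact familyOfPair_injective.comp (Prod.mk_right_injective _)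

end Families

namespace Hypergroup

variable {H : Type*} (hg : Hypergroup H)

/-- The subsets of `H`, as a monoid under the multiplication of subsets. -/
def Complex (_ : Hypergroup H) : Type _ := Set H

instance : Membership H hg.Complex := inferInstanceAs (Membership H (Set H))

instance : Singleton H hg.Complex := inferInstanceAs (Singleton H (Set H))

variable {hg}

/-- A subset of `H` as an element of the monoid `hg.Complex`. -/
def Complex.of (A : Set H) : hg.Complex := A

@[ext]
theorem Complex.ext {A B : hg.Complex} (h : ∀ x, x ∈ A ↔ x ∈ B) : A = B := Set.ext h

theorem Complex.mem_singleton {x y : H} : x ∈ ({y} : hg.Complex) ↔ x = y := Iff.rfl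

theorem Complex.singleton_injective {x y : H} (h : ({x} : hg.Complex) = {y}) : x = y :=
  Set.singleton_injective h

instance : Monoid hg.Complex where
  mul := hg.smul
  one := ({hg.e} : Set H)
  mul_assoc A B C := by
    refine Set.ext fun x => ⟨?_, ?_⟩
    · rintro ⟨y, ⟨a, ha, b, hb, hy⟩, c, hc, hx⟩
      have h : x ∈ ⋃ y ∈ hg.hmul a b, hg.hmul y c := Set.mem_iUnion₂.2 ⟨y, hy, hx⟩
      rw [hg.assoc] at h
      obtain ⟨z, hz, hx⟩ := Set.mem_iUnion₂.1 h
      exact ⟨a, ha, z, ⟨b, hb, c, hc, hz⟩, hx⟩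
    · rintro ⟨a, ha, z, ⟨b, hb, c, hc, hz⟩, hx⟩
      have h : x ∈ ⋃ z ∈ hg.hmul b c, hg.hmul a z := Set.mem_iUnion₂.2 ⟨z, hz, hx⟩
      rw [← hg.assoc] at h
      obtain ⟨y, hy, hx⟩ := Set.mem_iUnion₂.1 h
      exact ⟨y, ⟨a, ha, b, hb, hy⟩, c, hc, hx⟩
  one_mul A := by
    refine Set.ext fun x => ⟨?_, fun hx => ⟨hg.e, rfl, x, hx, by simp [hg.idl]⟩⟩
    rintro ⟨_, rfl, a, ha, hx⟩
    rw [hg.idl] at hx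
    exact hx ▸ ha
  mul_one A := by
    refine Set.ext fun x => ⟨?_, fun hx => ⟨x, hx, hg.e, rfl, by simp [hg.idr]⟩⟩
    rintro ⟨a, ha, _, rfl, hx⟩
    rw [hg.idr] at hx
    exact hx ▸ ha

theorem Complex.mem_mul {A B : hg.Complex} {x : H} :
    x ∈ A * B ↔ ∃ a ∈ A, ∃ b ∈ B, x ∈ hg.hmul a b := Iff.rfl

theorem Complex.mem_singleton_mul_singleton {a b x : H} :
    x ∈ ({a} * {b} : hg.Complex) ↔ x ∈ hg.hmul a b := by
  simp [mem_mul, mem_singleton]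

theorem Complex.listProd_eq_prod (l : List (Set H)) :
    hg.listProd l = List.prod (α := hg.Complex) l := by
  induction l with
  | nil => rfl
  | cons A l ih =>
    rw [listProd, ih]
    rfl

theorem e_mem_hmul_star (p : H) : hg.e ∈ hg.hmul p (hg.star p) :=
  (hg.h3l p hg.e p).1 (by simp [hg.idl])

theorem e_mem_star_hmul (p : H) : hg.e ∈ hg.hmul (hg.star p) p :=
  (hg.h3r p p hg.e).1 (by simp [hg.idr])

theorem star_star (p : H) : hg.star (hg.star p) = p := by
  have h : p ∈ hg.hmul (hg.star (hg.star p)) hg.e :=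
    (hg.h3r _ _ _).1 (e_mem_star_hmul p)
  rw [hg.idr] at h
  exact h.symm

theorem star_e : hg.star hg.e = hg.e := by
  have h := hg.e_mem_star_hmul hg.e
  rw [hg.idr] at h
  exact h.symm

theorem eq_star_of_e_mem_hmul {p r : H} (h : hg.e ∈ hg.hmul p r) : r = hg.star p := by
  have h := (hg.h3r _ _ _).1 h
  rwa [hg.idr] at h

theorem hmul_nonempty (p q : H) : (hg.hmul p q).Nonempty := by
  have h : p ∈ ({p} * ({q} * {hg.star q}) : hg.Complex) :=
    ⟨p, rfl, hg.e, Complex.mem_singleton_mul_singleton.2 (e_mem_hmul_star q), by simp [hg.idr]⟩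
  rw [← mul_assoc] at h
  obtain ⟨x, hx, -⟩ := h
  exact ⟨x, Complex.mem_singleton_mul_singleton.1 hx⟩

namespace IsClosed

variable {G : Set H}

theorem e_mem (hG : hg.IsClosed G) : hg.e ∈ G := by
  obtain ⟨g, hgG⟩ := hG.1
  exact hG.2 ⟨_, ⟨g, hgG, rfl⟩, g, hgG, e_mem_star_hmul g⟩

theorem star_mem (hG : hg.IsClosed G) {g : H} (hgG : g ∈ G) : hg.star g ∈ G :=
  hG.2 ⟨_, ⟨g, hgG, rfl⟩, hg.e, hG.e_mem, by simp [hg.idr]⟩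

theorem hmul_subset (hG : hg.IsClosed G) {g h : H} (hgG : g ∈ G) (hh : h ∈ G) :
    hg.hmul g h ⊆ G :=
  fun _ hx => hG.2 ⟨g, ⟨_, hG.star_mem hgG, star_star g⟩, h, hh, hx⟩

end IsClosed

theorem isClosed_iff_of_star_eq (hstar : ∀ x, hg.star x = x) {G : Set H} :
    hg.IsClosed G ↔ G.Nonempty ∧ ∀ a ∈ G, ∀ b ∈ G, hg.hmul a b ⊆ G := by
  refine ⟨fun hG => ⟨hG.1, fun a ha b hb => hG.hmul_subset ha hb⟩, fun hG => ⟨hG.1, ?_⟩⟩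
  rintro x ⟨_, ⟨a, ha, rfl⟩, b, hb, hx⟩
  exact hG.2 a ha b hb (hstar a ▸ hx)

namespace IsInvolution

variable {q : H}

theorem star_eq (hq : hg.IsInvolution q) : hg.star q = q := by
  refine (hq.2.star_mem (Or.inr rfl)).resolve_left fun h => hq.1 ?_
  rw [← star_star q, h, star_e]

theorem gen_eq (hq : hg.IsInvolution q) : hg.gen {q} = {hg.e, q} := by
  refine subset_antisymm (Set.sInter_subset_of_mem ⟨hq.2, by simp⟩) (Set.subset_sInter ?_)
  rintro C ⟨hC, hqC⟩ x (rfl | rfl)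
  · exact hC.e_mem
  · exact hqC rfl

theorem mem_hmul_self_iff (hq : hg.IsInvolution q) {x : H} :
    x ∈ hg.hmul q q ↔ x = hg.e ∨ (x = q ∧ hg.IsThick q) := by
  have he : hg.e ∈ hg.hmul q q := by
    simpa [hq.star_eq] using hg.e_mem_star_hmul q
  have hsub : hg.hmul q q ⊆ {hg.e, q} := hq.2.hmul_subset (Or.inr rfl) (Or.inr rfl)
  have hthin : hg.IsThin q ↔ hg.hmul q q = {hg.e} := by rw [IsThin, hq.star_eq]
  constructor
  · intro hx
    refine (hsub hx).imp_right fun h => ⟨h, fun ht => hq.1 ?_⟩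
    rw [hthin.1 ht] at hx
    exact h.symm.trans hx
  · rintro (rfl | ⟨rfl, hx⟩)
    · exact he
    · by_contra hxx
      refine hx (hthin.2 (subset_antisymm (fun y hy => (hsub hy).resolve_right ?_) (by simpa)))
      rintro rfl
      exact hxx hy

end IsInvolution

end Hypergroup

namespace EA2Data

open Hypergroup

variable {H : Type*} (E : EA2Data H)

theorem fam_eq (i : Fin E.n) : E.fam i = {E.hg.e, E.q i} := (E.invol i).gen_eq

theorem q_notMem_cofactor (i : Fin E.n) : E.q i ∉ E.hg.cofactor E.fam i := by
  intro h
  have hi : E.q i ∈ E.fam i ∩ E.hg.cofactor E.fam i := ⟨by simp [fam_eq], h⟩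
  have hdp : E.fam i ∩ E.hg.cofactor E.fam i = {E.hg.e} := E.dp.2.2 i
  rw [hdp] at hi
  exact (E.invol i).1 hi

theorem fam_subset_cofactor {i j : Fin E.n} (hij : j ≠ i) :
    E.fam j ⊆ E.hg.cofactor E.fam i := by
  have key (l : List (Fin E.n)) : E.hg.e ∈ E.hg.listProd (l.map E.fam) ∧
      (j ∈ l → E.fam j ⊆ E.hg.listProd (l.map E.fam)) := by
    induction l with
    | nil => exact ⟨rfl, by simp⟩
    | cons k l ih =>
      refine ⟨⟨E.hg.e, by simp [fam_eq], E.hg.e, ih.1, by simp [E.hg.idl]⟩, fun hj x hx => ?_⟩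
      rcases List.mem_cons.1 hj with rfl | hj
      · exact ⟨x, hx, E.hg.e, ih.1, by simp [E.hg.idr]⟩
      · exact ⟨E.hg.e, by simp [fam_eq], x, ih.2 hj hx, by simp [E.hg.idl]⟩
  exact (key _).2 (by simpa using hij)

theorem q_injective : Function.Injective E.q := by
  intro i j h
  by_contra hij
  refine E.q_notMem_cofactor i (E.fam_subset_cofactor (Ne.symm hij) ?_)
  simp [fam_eq, h]

theorem hmul_q_comm_subset {i j : Fin E.n} (hij : i ≠ j) :
    E.hg.hmul (E.q i) (E.q j) ⊆ E.hg.hmul (E.q j) (E.q i) := by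
  intro x hx
  have hnormal : E.hg.smul (E.fam i) {E.q j} = E.hg.smul {E.q j} (E.fam i) :=
    (E.dp.1 i).2.2.2 _ (Set.mem_univ _)
  have hmem : x ∈ E.hg.smul (E.fam i) {E.q j} := ⟨E.q i, by simp [fam_eq], E.q j, rfl, hx⟩
  rw [hnormal] at hmem
  obtain ⟨_, rfl, y, hy, hxy⟩ := hmem
  rw [fam_eq] at hy
  rcases hy with rfl | rfl
  · rw [E.hg.idr] at hxy
    obtain rfl : x = E.q j := hxy
    have h := (E.hg.h3l _ _ _).1 hx
    rw [(E.invol j).star_eq] at h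
    rcases (E.invol j).2.hmul_subset (Or.inr rfl) (Or.inr rfl) h with h | h
    · exact ((E.invol i).1 h).elim
    · exact (hij (E.q_injective h)).elim
  · exact hxy

theorem singleton_q_comm (i j : Fin E.n) :
    ({E.q i} * {E.q j} : E.hg.Complex) = {E.q j} * {E.q i} := by
  rcases eq_or_ne i j with rfl | hij
  · rfl
  · ext x
    simp only [Complex.mem_singleton_mul_singleton]
    exact ⟨fun h => E.hmul_q_comm_subset hij h, fun h => E.hmul_q_comm_subset hij.symm h⟩

theorem famProd_eq_singleton {r : Fin E.n → H} (hr : ∀ i, r i ∈ E.fam i) {x : H}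
    (hx : x ∈ E.hg.famProd r) : E.hg.famProd r = {x} := by
  refine subset_antisymm (fun y hy => ?_) (by simpa)
  have hc : E.hg.dcover E.fam x = {x} := E.constrained x
  rw [← hc]
  exact ⟨r, ⟨hr, hx⟩, hy⟩

theorem exists_famProd_eq (x : H) :
    ∃ r : Fin E.n → H, (∀ i, r i ∈ E.fam i) ∧ E.hg.famProd r = {x} := by
  have hc : E.hg.dcover E.fam x = {x} := E.constrained x
  obtain ⟨r, hr, -⟩ : x ∈ E.hg.dcover E.fam x := by simp [hc]
  exact ⟨r, hr.1, E.famProd_eq_singleton hr.1 hr.2⟩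

theorem singleton_mem_closure (x : H) :
    ({x} : E.hg.Complex) ∈ Submonoid.closure (Set.range fun i => ({E.q i} : E.hg.Complex)) := by
  obtain ⟨r, hr, hx⟩ := E.exists_famProd_eq x
  rw [famProd, Complex.listProd_eq_prod] at hx
  change ({x} : Set H) ∈ (_ : Set E.hg.Complex)
  rw [← hx]
  refine Submonoid.list_prod_mem _ fun A hA => ?_
  obtain ⟨i, -, rfl⟩ := List.mem_map.1 hA
  have hri := hr i
  rw [fam_eq] at hri
  rcases hri with h | h
  · rw [h]
    exact Submonoid.one_mem _
  · rw [h]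
    exact Submonoid.subset_closure ⟨i, rfl⟩

theorem singleton_comm (x y : H) : ({x} * {y} : E.hg.Complex) = {y} * {x} := by
  have h : IsMulCommutative
      (Submonoid.closure (Set.range fun i => ({E.q i} : E.hg.Complex))) := by
    refine Submonoid.isMulCommutative_closure _ ?_
    rintro _ ⟨i, rfl⟩ _ ⟨j, rfl⟩
    exact E.singleton_q_comm i j
  exact congrArg Subtype.val
    (h.is_comm.comm ⟨_, E.singleton_mem_closure x⟩ ⟨_, E.singleton_mem_closure y⟩)

theorem hmul_comm (x y : H) : E.hg.hmul x y = E.hg.hmul y x := by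
  ext z
  rw [← Complex.mem_singleton_mul_singleton, singleton_comm,
    Complex.mem_singleton_mul_singleton]

instance : CommMonoid E.hg.Complex where
  mul_comm A B := by
    ext x
    constructor <;> rintro ⟨a, ha, b, hb, hx⟩ <;> exact ⟨b, hb, a, ha, E.hmul_comm a b ▸ hx⟩

theorem mem_prod_iff {ι : Type*} (s : Finset ι) (A : ι → E.hg.Complex) {x : H} :
    x ∈ ∏ i ∈ s, A i ↔
      ∃ r : ι → H, (∀ i ∈ s, r i ∈ A i) ∧ x ∈ ∏ i ∈ s, ({r i} : E.hg.Complex) := by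
  classical
  induction s using Finset.induction_on generalizing x with
  | empty => exact ⟨fun h => ⟨fun _ => E.hg.e, by simp, h⟩, fun ⟨_, _, h⟩ => h⟩
  | insert i s hi ih =>
    constructor
    · rw [Finset.prod_insert hi]
      rintro ⟨a, ha, b, hb, hx⟩
      obtain ⟨r, hr, hb⟩ := ih.1 hb
      have hne {j : ι} (hj : j ∈ s) : j ≠ i := fun h => hi (h ▸ hj)
      refine ⟨Function.update r i a, ?_, ?_⟩
      · intro j hj
        rcases Finset.mem_insert.1 hj with rfl | hj
        · rwa [Function.update_self]
        · rw [Function.update_of_ne (hne hj)]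
          exact hr j hj
      · rw [Finset.prod_insert hi, Finset.prod_congr rfl fun j hj => by
          rw [Function.update_of_ne (hne hj)]]
        exact ⟨a, by rw [Function.update_self]; rfl, b, hb, hx⟩
    · rintro ⟨r, hr, hx⟩
      rw [Finset.prod_insert hi] at hx ⊢
      obtain ⟨a, rfl, b, hb, hx⟩ := hx
      exact ⟨_, hr i (by simp), b, ih.2 ⟨r, fun j hj => hr j (by simp [hj]), hb⟩, hx⟩

theorem famProd_eq_prod (r : Fin E.n → H) :
    (E.hg.famProd r : E.hg.Complex) = ∏ i, ({r i} : E.hg.Complex) := by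
  rw [Fin.prod_univ_def]
  exact Complex.listProd_eq_prod _

theorem cofactor_eq_prod (i : Fin E.n) :
    (Complex.of (E.hg.cofactor E.fam i) : E.hg.Complex) =
      ∏ j ∈ Finset.univ.erase i, Complex.of (E.fam j) := by
  rw [show Finset.univ.erase i = ((List.finRange E.n).filter fun j => decide (j ≠ i)).toFinset by
      ext j
      simp, List.prod_toFinset _ ((List.nodup_finRange _).filter _)]
  exact Complex.listProd_eq_prod _

/-- The element of `⟨q_i⟩` with coordinate `a`. -/
def coord (i : Fin E.n) (a : ZMod 2) : H := if a = 0 then E.hg.e else E.q i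

theorem coord_mem_fam (i : Fin E.n) (a : ZMod 2) : E.coord i a ∈ E.fam i := by
  rw [fam_eq, coord]
  split_ifs <;> simp

theorem exists_coord_eq {i : Fin E.n} {x : H} (hx : x ∈ E.fam i) : ∃ a, E.coord i a = x := by
  rw [fam_eq] at hx
  rcases hx with rfl | rfl
  · exact ⟨0, by simp [coord]⟩
  · exact ⟨1, by simp [coord]⟩

theorem exists_prod_coord_eq (s : Fin E.n → ZMod 2) :
    ∃ x, ∏ i, ({E.coord i (s i)} : E.hg.Complex) = {x} := by
  have hne (t : Finset (Fin E.n)) : ∃ x, x ∈ ∏ i ∈ t, ({E.coord i (s i)} : E.hg.Complex) := by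
    induction t using Finset.induction_on with
    | empty => exact ⟨E.hg.e, rfl⟩
    | insert i t hi ih =>
      obtain ⟨y, hy⟩ := ih
      obtain ⟨x, hx⟩ := E.hg.hmul_nonempty (E.coord i (s i)) y
      exact ⟨x, by
        rw [Finset.prod_insert hi]
        exact ⟨_, rfl, y, hy, hx⟩⟩
  obtain ⟨x, hx⟩ := hne Finset.univ
  rw [← famProd_eq_prod] at hx ⊢
  exact ⟨x, E.famProd_eq_singleton (fun i => E.coord_mem_fam i _) hx⟩

/-- The element of `H` with coordinates `s`. -/
noncomputable def ofCoords (s : Fin E.n → ZMod 2) : H := (E.exists_prod_coord_eq s).choose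

theorem prod_coord (s : Fin E.n → ZMod 2) :
    ∏ i, ({E.coord i (s i)} : E.hg.Complex) = {E.ofCoords s} :=
  (E.exists_prod_coord_eq s).choose_spec

theorem ofCoords_zero : E.ofCoords 0 = E.hg.e := by
  have h := E.prod_coord 0
  simp only [coord, Pi.zero_apply, if_true] at h
  exact (Complex.singleton_injective (h.symm.trans (Finset.prod_const_one))).trans rfl

theorem ofCoords_surjective : Function.Surjective E.ofCoords := by
  intro x
  obtain ⟨r, hr, hx⟩ := E.exists_famProd_eq x
  choose s hs using fun i => E.exists_coord_eq (hr i)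
  obtain rfl : (fun i => E.coord i (s i)) = r := funext hs
  refine ⟨s, Complex.singleton_injective (hg := E.hg) ?_⟩
  rw [← prod_coord, ← famProd_eq_prod]
  exact hx

/-- The set of indices of the thick involutions. -/
def thickIdx : Set (Fin E.n) := {i | E.hg.IsThick (E.q i)}

theorem mem_coord_mul_coord {i : Fin E.n} {a b : ZMod 2} {x : H} :
    x ∈ ({E.coord i a} * {E.coord i b} : E.hg.Complex) ↔
      ∃ c, x = E.coord i c ∧ (c = a + b ∨ (i ∈ E.thickIdx ∧ a = 1 ∧ b = 1)) := by
  rw [Complex.mem_singleton_mul_singleton]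
  rcases zmod_two_eq_zero_or_one a with rfl | rfl
  · simp [coord, E.hg.idl]
  rcases zmod_two_eq_zero_or_one b with rfl | rfl
  · simp [coord, E.hg.idr]
  have h11 : (1 + 1 : ZMod 2) = 0 := rfl
  have hcoord : E.hg.hmul (E.coord i 1) (E.coord i 1) = E.hg.hmul (E.q i) (E.q i) := by
    simp [coord]
  rw [hcoord, (E.invol i).mem_hmul_self_iff, h11]
  constructor
  · rintro (rfl | ⟨rfl, h⟩)
    · exact ⟨0, by simp [coord], Or.inl rfl⟩
    · exact ⟨1, by simp [coord], Or.inr ⟨h, rfl, rfl⟩⟩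
  · rintro ⟨c, rfl, rfl | ⟨h, -, -⟩⟩
    · exact Or.inl (by simp [coord])
    · rcases zmod_two_eq_zero_or_one c with rfl | rfl
      · exact Or.inl (by simp [coord])
      · exact Or.inr ⟨by simp [coord], h⟩

theorem mem_hmul_ofCoords {s t : Fin E.n → ZMod 2} {x : H} :
    x ∈ E.hg.hmul (E.ofCoords s) (E.ofCoords t) ↔
      ∃ u, OccursIn E.thickIdx s t u ∧ x = E.ofCoords u := by
  rw [← Complex.mem_singleton_mul_singleton, ← prod_coord, ← prod_coord,
    ← Finset.prod_mul_distrib, mem_prod_iff]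
  constructor
  · rintro ⟨r, hr, hx⟩
    choose u hu using fun i => E.mem_coord_mul_coord.1 (hr i (Finset.mem_univ i))
    obtain rfl : r = fun i => E.coord i (u i) := funext fun i => (hu i).1
    rw [prod_coord] at hx
    exact ⟨u, fun i => (hu i).2, hx⟩
  · rintro ⟨u, hu, rfl⟩
    refine ⟨fun i => E.coord i (u i), fun i _ => E.mem_coord_mul_coord.2 ⟨u i, rfl, hu i⟩, ?_⟩
    rw [prod_coord]
    rfl

theorem star_eq (x : H) : E.hg.star x = x := by
  obtain ⟨s, rfl⟩ := E.ofCoords_surjective x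
  refine (eq_star_of_e_mem_hmul (E.mem_hmul_ofCoords.2 ⟨0, fun i => Or.inl ?_, ?_⟩)).symm
  · exact (CharTwo.add_self_eq_zero (s i)).symm
  · exact E.ofCoords_zero.symm

theorem eq_zero_of_ofCoords_eq_e {u : Fin E.n → ZMod 2} (hu : E.ofCoords u = E.hg.e) : u = 0 := by
  funext i
  refine (zmod_two_eq_zero_or_one (u i)).resolve_right fun hui => E.q_notMem_cofactor i ?_
  have h := E.prod_coord u
  rw [← Finset.mul_prod_erase _ _ (Finset.mem_univ i), hu] at h
  have he : E.hg.e ∈ ({E.hg.e} : E.hg.Complex) := rfl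
  rw [← h] at he
  obtain ⟨_, rfl, y, hy, he⟩ := he
  have hcoord : E.coord i (u i) = E.q i := by simp [coord, hui]
  obtain rfl : y = E.q i := by
    rw [eq_star_of_e_mem_hmul he, hcoord, star_eq]
  change E.q i ∈ (Complex.of (E.hg.cofactor E.fam i) : E.hg.Complex)
  rw [cofactor_eq_prod, mem_prod_iff]
  exact ⟨_, fun j _ => E.coord_mem_fam j _, hy⟩

theorem ofCoords_injective : Function.Injective E.ofCoords := by
  intro s t h
  have he : E.hg.e ∈ E.hg.hmul (E.ofCoords s) (E.ofCoords t) := by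
    simpa [h, star_eq] using E.hg.e_mem_star_hmul (E.ofCoords t)
  obtain ⟨u, hu, he⟩ := E.mem_hmul_ofCoords.1 he
  obtain rfl := E.eq_zero_of_ofCoords_eq_e he.symm
  funext i
  rcases hu i with h | ⟨-, h, h'⟩
  · exact CharTwo.add_eq_zero.1 h.symm
  · rw [h, h']

theorem ofCoords_mem_hmul {s t u : Fin E.n → ZMod 2} :
    E.ofCoords u ∈ E.hg.hmul (E.ofCoords s) (E.ofCoords t) ↔ OccursIn E.thickIdx s t u := by
  rw [mem_hmul_ofCoords]
  constructor
  · rintro ⟨v, hv, h⟩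
    rwa [E.ofCoords_injective h]
  · exact fun h => ⟨u, h, rfl⟩

theorem isClosed_iff {G : Set H} :
    E.hg.IsClosed G ↔ IsClosedFamily E.thickIdx (E.ofCoords ⁻¹' G) := by
  rw [isClosed_iff_of_star_eq E.star_eq, IsClosedFamily]
  simp only [Set.subset_def, E.ofCoords_surjective.forall, ofCoords_mem_hmul, Set.mem_preimage]
  rw [← E.ofCoords_surjective.nonempty_preimage]

theorem isStronglyNormal_iff {G : Set H} :
    E.hg.IsStronglyNormal G Set.univ ↔
      IsStronglyNormalFamily E.thickIdx (E.ofCoords ⁻¹' G) := by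
  have huniv : E.hg.IsClosed Set.univ := ⟨⟨E.hg.e, trivial⟩, Set.subset_univ _⟩
  simp only [IsStronglyNormal, IsStronglyNormalFamily, isClosed_iff, huniv, Set.subset_univ,
    true_and, smul, Set.mem_univ, Set.mem_singleton_iff, exists_eq_left, Set.mem_preimage,
    E.star_eq]
  refine and_congr_right fun _ => ⟨fun h p s hs v hv u hu => ?_, ?_⟩
  · exact h (E.ofCoords p) trivial
      ⟨E.ofCoords v, ⟨_, hs, E.ofCoords_mem_hmul.2 hv⟩, E.ofCoords_mem_hmul.2 hu⟩
  · rintro h p - x ⟨y, ⟨z, hz, hy⟩, hx⟩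
    obtain ⟨p, rfl⟩ := E.ofCoords_surjective p
    obtain ⟨s, rfl⟩ := E.ofCoords_surjective z
    obtain ⟨v, hv, rfl⟩ := E.mem_hmul_ofCoords.1 hy
    obtain ⟨u, hu, rfl⟩ := E.mem_hmul_ofCoords.1 hx
    exact h p s hz v hv u hu

theorem ncard_preimage_ofCoords (p : Set (Fin E.n → ZMod 2) → Prop) :
    {G : Set H | p (E.ofCoords ⁻¹' G)}.ncard = {C | p C}.ncard := by
  rw [← Set.ncard_image_of_injective _ E.ofCoords_surjective.preimage_injective]
  congr 1
  ext C
  constructor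
  · rintro ⟨G, hG, rfl⟩
    exact hG
  · intro hC
    have h := Set.preimage_image_eq C E.ofCoords_injective
    exact ⟨E.ofCoords '' C, by simpa only [Set.mem_ofPred_eq, h] using hC, h⟩

end EA2Data

end HyperPaper

/-- The number of closed subsets of an elementary abelian 2-hypergroup H
equals 2^{p♯} Σ_{r=0}^{p−p♯} C(p−p♯, r)_2, and the number of strongly normal closed
subsets of H equals Σ_{r=0}^{p−p♯} C(p−p♯, r)_2. -/
theorem stmt10 {H : Type*} (E : EA2Data H) :
    {G : Set H | E.hg.IsClosed G}.ncard
        = 2 ^ E.psharp *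
          ∑ r ∈ Finset.range (E.n - E.psharp + 1), gaussBinom2 (E.n - E.psharp) r ∧
    {G : Set H | E.hg.IsStronglyNormal G Set.univ}.ncard
        = ∑ r ∈ Finset.range (E.n - E.psharp + 1), gaussBinom2 (E.n - E.psharp) r := by
  have hpsharp : E.thickIdx.ncard = E.psharp := rfl
  have hrank : Module.finrank (ZMod 2) ((E.thickIdxᶜ : Set (Fin E.n)) → ZMod 2) =
      E.n - E.psharp := by
    have := Fintype.ofFinite (E.thickIdxᶜ : Set (Fin E.n))
    rw [Module.finrank_pi, ← Nat.card_eq_fintype_card, Nat.card_coe_set_eq, Set.ncard_compl,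
      Nat.card_fin, hpsharp]
  simp only [E.isClosed_iff, E.isStronglyNormal_iff, E.ncard_preimage_ofCoords (IsClosedFamily _),
    E.ncard_preimage_ofCoords (IsStronglyNormalFamily _), ncard_isClosedFamily,
    ncard_isStronglyNormalFamily, card_submodule_eq_sum_gaussBinom2 _ hrank, hpsharp, and_self]
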